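/- arXiv:2103.01286 — 2 statements merged into one kernel-verified Lean document; each statement's English description precedes it below -/
import Mathlib

section
/- Let (h, q) be a smooth solution of the dispersive Serre–Green–Naghdi model with topography on ℝ^d × (0,∞) with h > 0. Define the energy E := (1/2)g(h+z)² + (1/2)h|v|² + (1/6)h((ḣ + (3/2)(v·∇z))² + (3/4)(v·∇z)²) and the energy flux F := v(E − (1/2)g z² + p). Then ∂_t E + div F = 0 identically. -/
noncomputable section
open scoped BigOperators

/-- Physical space `ℝ^d`. -/
abbrev Spc (d : ℕ) := EuclideanSpace ℝ (Fin d)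
/-- Space-time `ℝ^d × ℝ` (time is the second component). -/
abbrev SpT (d : ℕ) := Spc d × ℝ

/-- Time derivative `∂_t f`. -/
noncomputable def dT {d : ℕ} (f : SpT d → ℝ) (p : SpT d) : ℝ :=
  deriv (fun t => f (p.1, t)) p.2

/-- `i`-th spatial partial derivative `∂_i f` of a space-time function. -/
noncomputable def dX {d : ℕ} (i : Fin d) (f : SpT d → ℝ) (p : SpT d) : ℝ :=
  fderiv ℝ (fun x => f (x, p.2)) p.1 (EuclideanSpace.single i 1)

/-- `i`-th spatial partial derivative `∂_i z` of a time-independent function. -/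
noncomputable def dZ {d : ℕ} (i : Fin d) (z : Spc d → ℝ) (x : Spc d) : ℝ :=
  fderiv ℝ z x (EuclideanSpace.single i 1)

/-- Divergence `div u = ∑_i ∂_i u_i` of a vector field. -/
noncomputable def divF {d : ℕ} (u : SpT d → Spc d) (p : SpT d) : ℝ :=
  ∑ i, dX i (fun q => u q i) p

/-- Divergence `div (f v) = ∑_i ∂_i (v_i f)` of a scalar multiple of a vector field. -/
noncomputable def divSV {d : ℕ} (v : SpT d → Spc d) (f : SpT d → ℝ) (p : SpT d) : ℝ :=
  ∑ i, dX i (fun q => v q i * f q) p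

/-- Advection term `v·∇f`. -/
noncomputable def adv {d : ℕ} (v : SpT d → Spc d) (f : SpT d → ℝ) (p : SpT d) : ℝ :=
  ∑ i, v p i * dX i f p

/-- `v·∇z` for the (time-independent) bathymetry `z`. -/
noncomputable def advZ {d : ℕ} (v : SpT d → Spc d) (z : Spc d → ℝ) (p : SpT d) : ℝ :=
  ∑ i, v p i * dZ i z p.1

section Calculus

variable {d : ℕ} {f f₁ f₂ : SpT d → ℝ} {v : SpT d → Spc d} {p : SpT d}

/-- The time derivative is the Fréchet derivative in the direction `(0, 1)`. -/
lemma dT_eq_fderiv (hf : DifferentiableAt ℝ f p) : dT f p = fderiv ℝ f p (0, 1) := by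
  have h₁ : HasDerivAt (fun t : ℝ => ((p.1, t) : SpT d)) (0, 1) p.2 :=
    (hasDerivAt_const _ _).prodMk (hasDerivAt_id _)
  exact (hf.hasFDerivAt.comp_hasDerivAt (f := fun t : ℝ => ((p.1, t) : SpT d)) p.2 h₁).deriv

/-- A spatial partial derivative is the Fréchet derivative in the direction `(e_i, 0)`. -/
lemma dX_eq_fderiv (i : Fin d) (hf : DifferentiableAt ℝ f p) :
    dX i f p = fderiv ℝ f p (EuclideanSpace.single i 1, 0) := by
  have h₁ : HasFDerivAt (fun x : Spc d => ((x, p.2) : SpT d))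
      ((ContinuousLinearMap.id ℝ (Spc d)).prod 0) p.1 :=
    (hasFDerivAt_id _).prodMk (hasFDerivAt_const _ _)
  have h₂ := hf.hasFDerivAt.comp (f := fun x : Spc d => ((x, p.2) : SpT d)) p.1 h₁
  rw [dX, show (fun x => f (x, p.2)) = f ∘ fun x : Spc d => ((x, p.2) : SpT d) from rfl, h₂.fderiv]
  simp

/-- The material derivative `∂_t f + v·∇f` is the Fréchet derivative in the direction `(v, 1)`. -/
lemma dT_add_adv (hf : DifferentiableAt ℝ f p) :
    dT f p + adv v f p = fderiv ℝ f p (v p, 1) := by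
  have hvp : ((v p, 1) : SpT d) =
      (0, 1) + ∑ i, v p i • ((EuclideanSpace.single i 1, 0) : SpT d) := by
    refine Prod.ext ?_ ?_
    · ext j
      simp [Prod.fst_sum, Pi.single_apply]
    · simp [Prod.snd_sum]
  rw [hvp, map_add, map_sum, dT_eq_fderiv hf, adv]
  simp only [map_smul, smul_eq_mul, dX_eq_fderiv _ hf]

lemma contDiff_dT (hf : ContDiff ℝ (⊤ : ℕ∞) f) : ContDiff ℝ (⊤ : ℕ∞) (dT f) := by
  have : dT f = fun p => fderiv ℝ f p (0, 1) :=
    funext fun p => dT_eq_fderiv (hf.differentiable (by simp) p)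
  rw [this]
  exact (hf.fderiv_right (by simp)).clm_apply contDiff_const

lemma contDiff_dX (i : Fin d) (hf : ContDiff ℝ (⊤ : ℕ∞) f) : ContDiff ℝ (⊤ : ℕ∞) (dX i f) := by
  have : dX i f = fun p => fderiv ℝ f p (EuclideanSpace.single i 1, 0) :=
    funext fun p => dX_eq_fderiv i (hf.differentiable (by simp) p)
  rw [this]
  exact (hf.fderiv_right (by simp)).clm_apply contDiff_const

lemma contDiff_adv (hv : ∀ i, ContDiff ℝ (⊤ : ℕ∞) fun p => v p i)
    (hf : ContDiff ℝ (⊤ : ℕ∞) f) : ContDiff ℝ (⊤ : ℕ∞) (adv v f) :=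
  ContDiff.sum fun i _ => (hv i).mul (contDiff_dX i hf)

lemma contDiff_advZ {z : Spc d → ℝ} (hv : ∀ i, ContDiff ℝ (⊤ : ℕ∞) fun p => v p i)
    (hz : ContDiff ℝ (⊤ : ℕ∞) z) : ContDiff ℝ (⊤ : ℕ∞) (advZ v z) :=
  ContDiff.sum fun i _ => (hv i).mul
    (((hz.fderiv_right (by simp)).clm_apply contDiff_const).comp contDiff_fst)

lemma dX_mul (i : Fin d) (h₁ : DifferentiableAt ℝ f₁ p) (h₂ : DifferentiableAt ℝ f₂ p) :
    dX i (fun q => f₁ q * f₂ q) p = f₁ p * dX i f₂ p + f₂ p * dX i f₁ p := by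
  rw [dX_eq_fderiv i (h₁.fun_mul h₂), dX_eq_fderiv i h₁, dX_eq_fderiv i h₂, fderiv_fun_mul h₁ h₂]
  simp

lemma divSV_eq (hv : ∀ i, DifferentiableAt ℝ (fun q => v q i) p) (hf : DifferentiableAt ℝ f p) :
    divSV v f p = adv v f p + f p * divF v p := by
  simp only [divSV, adv, divF, dX_mul _ (hv _) hf, Finset.sum_add_distrib, Finset.mul_sum]

lemma adv_add (h₁ : DifferentiableAt ℝ f₁ p) (h₂ : DifferentiableAt ℝ f₂ p) :
    adv v (fun q => f₁ q + f₂ q) p = adv v f₁ p + adv v f₂ p := by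
  have h₁₂ (i : Fin d) : dX i (fun q => f₁ q + f₂ q) p = dX i f₁ p + dX i f₂ p := by
    rw [dX_eq_fderiv i (h₁.fun_add h₂), dX_eq_fderiv i h₁, dX_eq_fderiv i h₂, fderiv_fun_add h₁ h₂]
    simp
  simp only [adv, h₁₂, mul_add, Finset.sum_add_distrib]

lemma fderiv_comp_fst {z : Spc d → ℝ} (hz : DifferentiableAt ℝ z p.1) :
    fderiv ℝ (fun q : SpT d => z q.1) p (v p, 1) = advZ v z p := by
  rw [← dT_add_adv (f := fun q : SpT d => z q.1) (hz.comp p differentiableAt_fst)]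
  simp [dT, adv, advZ, dX, dZ]

end Calculus

/-- Energy conservation for smooth solutions of the dispersive
Serre--Green--Naghdi model with topography: `∂_t E + div F = 0`. -/
theorem sgn_energy_balance
    {d : ℕ} (g : ℝ) (hg : 0 < g)
    (z : Spc d → ℝ) (zsm : ContDiff ℝ (⊤ : ℕ∞) z)
    (h : SpT d → ℝ) (Q : SpT d → Spc d)
    (hsm : ContDiff ℝ (⊤ : ℕ∞) h) (Qsm : ContDiff ℝ (⊤ : ℕ∞) Q)
    (hpos : ∀ p : SpT d, 0 < h p)
    -- velocity `v := q / h`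
    (v : SpT d → Spc d) (hv : ∀ p, v p = (h p)⁻¹ • Q p)
    -- material derivatives `ḣ`, `ḧ`, `k̇`
    (hdot : SpT d → ℝ) (hhdot : ∀ p, hdot p = dT h p + adv v h p)
    (hddot : SpT d → ℝ) (hhddot : ∀ p, hddot p = dT hdot p + adv v hdot p)
    (kdot : SpT d → ℝ)
    (hkdot : ∀ p, kdot p = dT (fun q => advZ v z q) p + adv v (fun q => advZ v z q) p)
    -- pressure `p := ½ g h² + h² (⅓ ḧ + ½ k̇)`
    (P : SpT d → ℝ)
    (hP : ∀ p, P p = (1/2) * g * (h p)^2 + (h p)^2 * ((1/3) * hddot p + (1/2) * kdot p))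
    -- source `r := g h + h (½ ḧ + k̇)`
    (R : SpT d → ℝ)
    (hR : ∀ p, R p = g * h p + h p * ((1/2) * hddot p + kdot p))
    -- the model: mass and momentum conservation on `ℝ^d × (0,∞)`
    (mass : ∀ p : SpT d, 0 < p.2 → dT h p + divF Q p = 0)
    (momentum : ∀ p : SpT d, 0 < p.2 → ∀ i : Fin d,
      dT (fun q => Q q i) p + (∑ j, dX j (fun q => v q j * Q q i) p)
        + dX i P p + R p * dZ i z p.1 = 0)
    -- energy `E` and energy flux `F`
    (E : SpT d → ℝ)
    (hE : ∀ p, E p = (1/2) * g * (h p + z p.1)^2 + (1/2) * h p * (∑ i, (v p i)^2)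
      + (1/6) * h p * ((hdot p + (3/2) * advZ v z p)^2 + (3/4) * (advZ v z p)^2))
    (F : SpT d → Spc d)
    (hF : ∀ p, ∀ i : Fin d, F p i = v p i * (E p - (1/2) * g * (z p.1)^2 + P p)) :
    ∀ p : SpT d, 0 < p.2 → dT E p + divF F p = 0 := by
  intro p hp
  have nh : h p ≠ 0 := (hpos p).ne'
  have vs (i : Fin d) : ContDiff ℝ (⊤ : ℕ∞) fun q => v q i := by
    simp only [hv, PiLp.smul_apply, smul_eq_mul]
    exact (hsm.inv fun q => (hpos q).ne').mul ((contDiff_piLp 2).1 Qsm i)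
  have hQ (q : SpT d) (i : Fin d) : Q q i = v q i * h q := by
    rw [hv, PiLp.smul_apply, smul_eq_mul]
    field_simp [(hpos q).ne']
  have ws := contDiff_advZ vs zsm
  have hds : ContDiff ℝ (⊤ : ℕ∞) hdot := by
    rw [funext hhdot]; exact (contDiff_dT hsm).add (contDiff_adv vs hsm)
  have hdds : ContDiff ℝ (⊤ : ℕ∞) hddot := by
    rw [funext hhddot]; exact (contDiff_dT hds).add (contDiff_adv vs hds)
  have ks : ContDiff ℝ (⊤ : ℕ∞) kdot := by
    rw [funext hkdot]; exact (contDiff_dT ws).add (contDiff_adv vs ws)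
  have Ps : ContDiff ℝ (⊤ : ℕ∞) P := by
    rw [funext hP]; fun_prop
  have diff {f : SpT d → ℝ} (hf : ContDiff ℝ (⊤ : ℕ∞) f) : DifferentiableAt ℝ f p :=
    hf.differentiable (by simp) p
  have vd (i : Fin d) := diff (vs i)
  have zd : DifferentiableAt ℝ z p.1 := zsm.differentiable (by simp) _
  -- mass conservation in the form `ḣ = -h div v`
  have hmass : hdot p + h p * divF v p = 0 := by
    have h₁ := mass p hp
    have h₂ : divF Q p = divSV v h p := by simp only [divF, divSV, hQ]
    rw [h₂, divSV_eq vd (diff hsm)] at h₁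
    rw [hhdot]
    linarith
  -- momentum conservation in the form `h (∂_t v + v·∇v) = -∇P - R ∇z`
  have hmom (i : Fin d) : h p * fderiv ℝ (fun q => v q i) p (v p, 1)
      + dX i P p + R p * dZ i z p.1 = 0 := by
    have h₁ := momentum p hp i
    have hvh : DifferentiableAt ℝ (fun q => v q i * h q) p := (vd i).mul (diff hsm)
    have h₂ := divSV_eq vd hvh
    have h₃ := dT_add_adv (v := v) hvh
    rw [fderiv_fun_mul (vd i) (diff hsm)] at h₃
    have h₄ := dT_add_adv (v := v) (diff hsm)
    rw [← hhdot] at h₄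
    simp only [hQ] at h₁
    change _ + divSV v (fun q => v q i * h q) p + _ + _ = 0 at h₁
    simp only [add_apply, smul_apply, smul_eq_mul] at h₃
    linear_combination h₁ - h₂ - h₃ + v p i * h₄ - v p i * hmass
  have hmomv : h p * ∑ i, v p i * fderiv ℝ (fun q => v q i) p (v p, 1)
      + adv v P p + R p * advZ v z p = 0 := by
    simp only [adv, advZ, Finset.mul_sum, ← Finset.sum_add_distrib]
    refine Finset.sum_eq_zero fun i _ => ?_
    linear_combination v p i * hmom i
  -- the energy without its time-independent part
  let G : SpT d → ℝ := fun q => (1/2) * g * (h q)^2 + g * (h q * z q.1)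
    + (1/2) * (h q * ∑ i, (v q i)^2)
    + (1/6) * (h q * ((hdot q)^2 + 3 * (hdot q * advZ v z q) + 3 * (advZ v z q)^2))
  have hEG (q : SpT d) : E q = G q + (1/2) * g * (z q.1)^2 := by
    rw [hE]; ring
  have Gs : ContDiff ℝ (⊤ : ℕ∞) G := by
    have : ContDiff ℝ (⊤ : ℕ∞) fun q : SpT d => z q.1 := zsm.comp contDiff_fst
    have : ContDiff ℝ (⊤ : ℕ∞) fun q => ∑ i, (v q i)^2 := ContDiff.sum fun i _ => (vs i).pow 2
    fun_prop
  have hdTE : dT E p = dT G p := by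
    simp only [dT, hEG, deriv_add_const]
  have hdivF : divF F p = adv v G p + adv v P p + (G p + P p) * divF v p := by
    have h₁ : divF F p = divSV v (fun q => G q + P q) p := by
      simp only [divF, divSV, hF, hEG]
      refine Finset.sum_congr rfl fun i _ => ?_
      congr 1
      funext q
      ring
    rw [h₁, divSV_eq vd ((diff Gs).fun_add (diff Ps)), adv_add (diff Gs) (diff Ps)]
  have hDh : fderiv ℝ h p (v p, 1) = hdot p := by rw [hhdot, dT_add_adv (diff hsm)]
  have hDhd : fderiv ℝ hdot p (v p, 1) = hddot p := by rw [hhddot, dT_add_adv (diff hds)]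
  have hDw : fderiv ℝ (advZ v z) p (v p, 1) = kdot p := by rw [hkdot, dT_add_adv (diff ws)]
  have hDG : fderiv ℝ G p (v p, 1) = g * h p * hdot p + g * (hdot p * z p.1 + h p * advZ v z p)
      + (1/2) * (hdot p * (∑ i, (v p i)^2)
        + h p * (2 * ∑ i, v p i * fderiv ℝ (fun q => v q i) p (v p, 1)))
      + (1/6) * (hdot p * ((hdot p)^2 + 3 * (hdot p * advZ v z p) + 3 * (advZ v z p)^2)
        + h p * (2 * hdot p * hddot p + 3 * (hddot p * advZ v z p + hdot p * kdot p)
          + 6 * advZ v z p * kdot p)) := by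
    have h₁ := (diff hsm).hasFDerivAt
    have h₂ := (zd.comp p differentiableAt_fst).hasFDerivAt
    have h₃ := HasFDerivAt.fun_sum (u := Finset.univ) fun i _ => (vd i).hasFDerivAt.pow 2
    have h₄ := (diff hds).hasFDerivAt
    have h₅ := (diff ws).hasFDerivAt
    have hzv : fderiv ℝ (z ∘ Prod.fst) p (v p, 1) = advZ v z p := fderiv_comp_fst zd
    have hG := ((((h₁.pow 2).const_mul ((1/2) * g)).add ((h₁.mul h₂).const_mul g)).add
      ((h₁.mul h₃).const_mul (1/2))).add ((h₁.mul (((h₄.pow 2).add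
        ((h₄.mul h₅).const_mul 3)).add ((h₅.pow 2).const_mul 3))).const_mul (1/6))
    have hG' := congrArg (fun L => L (v p, 1)) (HasFDerivAt.fderiv (f := G) hG)
    simp only [add_apply, smul_apply, smul_eq_mul,
      sum_apply, hDh, hDhd, hDw, hzv] at hG'
    rw [hG', Finset.mul_sum _ _ (2 : ℝ)]
    simp [mul_assoc]
    ring
  have hDG' := dT_add_adv (v := v) (diff Gs)
  rw [hdTE, hdivF]
  have hdiv : divF v p = -hdot p / h p := by
    field_simp
    linarith
  rw [hR] at hmomv
  have : adv v P p = -(h p * ∑ i, v p i * fderiv ℝ (fun q => v q i) p (v p, 1)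
      + (g * h p + h p * ((1/2) * hddot p + kdot p)) * advZ v z p) := by linarith
  rw [this, hdiv, hP]
  have hsum : dT G p = _ := eq_sub_of_add_eq (hDG'.trans hDG)
  rw [hsum]
  simp only [G]
  field_simp
  ring
end
end

section
/- Let (h, q) with h > 0 and constant discharge q ≠ 0 be a smooth time-independent solution of the one-dimensional dispersive Serre–Green–Naghdi model with topography z. Then the energy flux F(x) := v(x)(E(x) − (1/2)g z(x)² + p(x)) is constant in x, where E := (1/2)g(h+z)² + (1/2)h v² + (1/6)h((ḣ + (3/2) v ∂_x z)² + (3/4)(v ∂_x z)²). -/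
noncomputable section

/-- For a smooth time-independent solution of the one-dimensional dispersive
Serre--Green--Naghdi model with topography (`h > 0`, constant discharge `q ≠ 0`), the energy
flux `F = v (E - ½ g z² + p)` is constant in `x`. -/
theorem sgn_steady_flux_constant
    (g : ℝ) (hg : 0 < g)
    (q : ℝ) (hq : q ≠ 0)
    (z : ℝ → ℝ) (zsm : ContDiff ℝ (⊤ : ℕ∞) z)
    (h : ℝ → ℝ) (hsm : ContDiff ℝ (⊤ : ℕ∞) h) (hpos : ∀ x, 0 < h x)
    -- velocity and steady material derivatives
    (v : ℝ → ℝ) (hv : ∀ x, v x = q / h x)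
    (hdot : ℝ → ℝ) (hhdot : ∀ x, hdot x = v x * deriv h x)
    (hddot : ℝ → ℝ) (hhddot : ∀ x, hddot x = v x * deriv hdot x)
    (kdot : ℝ → ℝ) (hkdot : ∀ x, kdot x = v x * deriv (fun y => v y * deriv z y) x)
    -- pressure and topography source
    (P : ℝ → ℝ)
    (hP : ∀ x, P x = (1/2) * g * (h x)^2 + (h x)^2 * ((1/3) * hddot x + (1/2) * kdot x))
    (R : ℝ → ℝ)
    (hR : ∀ x, R x = g * h x + h x * ((1/2) * hddot x + kdot x))
    -- the steady model: `∂_x q = 0` (trivial) and `∂_x(q²/h + p) + r(u) ∂_x z = 0`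
    (steady : ∀ x : ℝ, deriv (fun y => q^2 / h y + P y) x + R x * deriv z x = 0)
    -- energy and energy flux
    (E : ℝ → ℝ)
    (hE : ∀ x, E x = (1/2) * g * (h x + z x)^2 + (1/2) * h x * (v x)^2
      + (1/6) * h x * ((hdot x + (3/2) * v x * deriv z x)^2 + (3/4) * (v x * deriv z x)^2))
    (F : ℝ → ℝ)
    (hF : ∀ x, F x = v x * (E x - (1/2) * g * (z x)^2 + P x)) :
    ∀ x y : ℝ, F x = F y := by
  have hne : ∀ x, h x ≠ 0 := fun x => (hpos x).ne'
  have contDiff_deriv : ∀ {f : ℝ → ℝ}, ContDiff ℝ (⊤ : ℕ∞) f → ContDiff ℝ (⊤ : ℕ∞) (deriv f) :=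
    fun hf => (contDiff_infty_iff_deriv.1 hf).2
  have v_smooth : ContDiff ℝ (⊤ : ℕ∞) v := by
    rw [funext hv]
    exact contDiff_const.div hsm hne
  have hdot_smooth : ContDiff ℝ (⊤ : ℕ∞) hdot := by
    rw [funext hhdot]
    exact v_smooth.mul (contDiff_deriv hsm)
  have hddot_smooth : ContDiff ℝ (⊤ : ℕ∞) hddot := by
    rw [funext hhddot]
    exact v_smooth.mul (contDiff_deriv hdot_smooth)
  -- `w = v ∂ₓz`
  obtain ⟨w, hw⟩ : ∃ w : ℝ → ℝ, ∀ x, w x = v x * deriv z x := ⟨_, fun _ => rfl⟩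
  have w_smooth : ContDiff ℝ (⊤ : ℕ∞) w := by
    rw [funext hw]
    exact v_smooth.mul (contDiff_deriv zsm)
  have kdot_eq : ∀ x, kdot x = v x * deriv w x := fun x => by rw [hkdot, funext hw]
  have kdot_smooth : ContDiff ℝ (⊤ : ℕ∞) kdot := by
    rw [funext kdot_eq]
    exact v_smooth.mul (contDiff_deriv w_smooth)
  have P_smooth : ContDiff ℝ (⊤ : ℕ∞) P := by
    rw [funext hP]
    fun_prop
  have hasDeriv : ∀ {f : ℝ → ℝ}, ContDiff ℝ (⊤ : ℕ∞) f → ∀ x, HasDerivAt f (deriv f x) x :=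
    fun hf x => (hf.differentiable (by simp) x).hasDerivAt
  -- Dividing by `q = h v`, the flux becomes a Bernoulli-type head.
  have F_eq : F = fun x => q * (g * h x / 2 + g * z x + v x ^ 2 / 2
      + ((hdot x + 3 / 2 * w x) ^ 2 + 3 / 4 * w x ^ 2) / 6 + P x / h x) := by
    funext x
    have hx := hne x
    rw [hF, hE, hw, hv]
    field_simp
    ring
  have F_deriv : ∀ x, HasDerivAt F 0 x := by
    intro x
    have hx := hne x
    have dh := hasDeriv hsm x
    have dz := hasDeriv zsm x
    have dv := hasDeriv v_smooth x
    have da := hasDeriv hdot_smooth x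
    have dw := hasDeriv w_smooth x
    have dP := hasDeriv P_smooth x
    have v_deriv : deriv v x = -(q * deriv h x) / h x ^ 2 := by
      have quotient := ((hasDerivAt_const x q).div dh hx).deriv
      change deriv (fun y => q / h y) x = _ at quotient
      rw [funext hv, quotient]
      ring
    have P_deriv : deriv P x = q ^ 2 * deriv h x / h x ^ 2 - R x * deriv z x := by
      have momentum := (((hasDerivAt_const x (q ^ 2)).div dh hx).add dP).deriv
      have balance := steady x
      change deriv (fun y => q ^ 2 / h y + P y) x = _ at momentum
      rw [momentum] at balance
      linear_combination balance
    rw [F_eq]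
    have dF := ((((((dh.const_mul g).div_const 2).add (dz.const_mul g)).add
      ((dv.pow 2).div_const 2)).add
      ((((da.add (dw.const_mul (3 / 2))).pow 2).add
        ((dw.pow 2).const_mul (3 / 4))).div_const 6)).add (dP.div dh hx)).const_mul q
    refine dF.congr_deriv ?_
    simp only [Pi.add_apply, Nat.add_one_sub_one, pow_one, Nat.cast_ofNat]
    rw [P_deriv, v_deriv, hR, hP, hhddot, kdot_eq, hhdot, hw, hv]
    field_simp
    ring
  exact fun x y => is_const_of_deriv_eq_zero (fun x => (F_deriv x).differentiableAt)
    (fun x => (F_deriv x).deriv) x y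
end
end
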